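/- Completeness of the new interactive semantics with respect to the old semantics: for every program P (a set of D-formulas) and every goal G (a G-formula), if G is solvable from P under the old uniform-provability semantics `prov`, then executing G from P succeeds under the new operational semantics `prove` (for every choice i ∈ {0,1} the user can make at an additive-conjunctive goal G₀ & G₁, the corresponding prove-derivation exists). -/

import Mathlib

/-- Goals (G-formulas) of Prolog^{⊕,&}:
`G ::= A | G ⊗ G | ∃x G | G & G | G ⊕ G`.
Quantification is rendered in higher-order abstract syntax over an abstract
type `Term` of first-order terms, so that `[t/x]G` is function application. -/
inductive Goal (Atom : Type) (Term : Type) : Type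
  | atom   : Atom → Goal Atom Term                          -- A
  | tensor : Goal Atom Term → Goal Atom Term → Goal Atom Term -- G₁ ⊗ G₂
  | ex     : (Term → Goal Atom Term) → Goal Atom Term         -- ∃x G
  | wth    : Goal Atom Term → Goal Atom Term → Goal Atom Term -- G₁ & G₂
  | plus   : Goal Atom Term → Goal Atom Term → Goal Atom Term -- G₁ ⊕ G₂

/-- Clauses (D-formulas): `D ::= A | G ⊃ A | ∀x D`. -/
inductive Clause (Atom : Type) (Term : Type) : Type
  | atom : Atom → Clause Atom Term                            -- A
  | imp  : Goal Atom Term → Atom → Clause Atom Term           -- G ⊃ A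
  | all  : (Term → Clause Atom Term) → Clause Atom Term       -- ∀x D

/- The old uniform-provability semantics `prov`, as a pair of mutually
inductive judgments: `Prov P G` (goal-reduction phase) and
`ProvBC P D A` (backchaining phase with distinguished clause `D`,
i.e. `prov(D;P, A)` where `D;P = {D} ∪ P` with `D` distinguished). -/
mutual
inductive Prov {Atom Term : Type} : Set (Clause Atom Term) → Goal Atom Term → Prop
  | atom {P D A} : D ∈ P → ProvBC P D A → Prov P (Goal.atom A)
  | tensor {P G₁ G₂} : Prov P G₁ → Prov P G₂ → Prov P (Goal.tensor G₁ G₂)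
  | wth {P G₁ G₂} : Prov P G₁ → Prov P G₂ → Prov P (Goal.wth G₁ G₂)
  | plusL {P G₁ G₂} : Prov P G₁ → Prov P (Goal.plus G₁ G₂)
  | plusR {P G₁ G₂} : Prov P G₂ → Prov P (Goal.plus G₁ G₂)
  | ex {P} {G : Term → Goal Atom Term} (t : Term) : Prov P (G t) → Prov P (Goal.ex G)

inductive ProvBC {Atom Term : Type} : Set (Clause Atom Term) → Clause Atom Term → Atom → Prop
  | atom {P A} : ProvBC P (Clause.atom A) A
  | imp {P G₁ A} : Prov P G₁ → ProvBC P (Clause.imp G₁ A) A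
  | all {P} {D : Term → Clause Atom Term} {A} (t : Term) :
      ProvBC P (D t) A → ProvBC P (Clause.all D) A
end

/- The new interactive semantics `prove`: same as `prov` except for the
`&`-rule, which lets the user choose `i ∈ {0,1}`, solves the chosen conjunct
`G_i` with `prove`, and the unchosen conjunct `G_{(i+1) mod 2}` with `prov`. -/
mutual
inductive Prove {Atom Term : Type} : Set (Clause Atom Term) → Goal Atom Term → Prop
  | atom {P D A} : D ∈ P → ProveBC P D A → Prove P (Goal.atom A)
  | tensor {P G₁ G₂} : Prove P G₁ → Prove P G₂ → Prove P (Goal.tensor G₁ G₂)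
  | wthL {P G₀ G₁} : Prove P G₀ → Prov P G₁ → Prove P (Goal.wth G₀ G₁)  -- user chose i = 0
  | wthR {P G₀ G₁} : Prove P G₁ → Prov P G₀ → Prove P (Goal.wth G₀ G₁)  -- user chose i = 1
  | plusL {P G₁ G₂} : Prove P G₁ → Prove P (Goal.plus G₁ G₂)
  | plusR {P G₁ G₂} : Prove P G₂ → Prove P (Goal.plus G₁ G₂)
  | ex {P} {G : Term → Goal Atom Term} (t : Term) : Prove P (G t) → Prove P (Goal.ex G)

inductive ProveBC {Atom Term : Type} : Set (Clause Atom Term) → Clause Atom Term → Atom → Prop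
  | atom {P A} : ProveBC P (Clause.atom A) A
  | imp {P G₁ A} : Prove P G₁ → ProveBC P (Clause.imp G₁ A) A
  | all {P} {D : Term → Clause Atom Term} {A} (t : Term) :
      ProveBC P (D t) A → ProveBC P (Clause.all D) A
end

mutual
theorem Prov.toProve {Atom Term : Type} {P : Set (Clause Atom Term)} {G : Goal Atom Term} :
    Prov P G → Prove P G
  | .atom hD h => .atom hD h.toProveBC
  | .tensor h₁ h₂ => .tensor h₁.toProve h₂.toProve
  | .wth h₁ h₂ => .wthL h₁.toProve h₂
  | .plusL h => .plusL h.toProve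
  | .plusR h => .plusR h.toProve
  | .ex t h => .ex t h.toProve

theorem ProvBC.toProveBC {Atom Term : Type} {P : Set (Clause Atom Term)} {D : Clause Atom Term}
    {A : Atom} : ProvBC P D A → ProveBC P D A
  | .atom => .atom
  | .imp h => .imp h.toProve
  | .all t h => .all t h.toProveBC
end

/-- **Completeness** of the new interactive semantics w.r.t. the old
semantics: for every program `P` (a set of D-formulas) and every goal `G`,
if `G` is solvable from `P` under the old uniform-provability semantics
`prov`, then executing `G` from `P` succeeds under the new semantics `prove`;
indeed, at an `&`-goal `G₀ & G₁` both user choices `i ∈ {0,1}` (the rules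
`Prove.wthL` and `Prove.wthR`) are available, so the prove-derivation exists
for every choice the user can make. -/
theorem prove_completeness {Atom Term : Type}
    (P : Set (Clause Atom Term)) (G : Goal Atom Term) :
    Prov P G → Prove P G := by
  exact Prov.toProve
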